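/- arXiv:1302.2991 — 4 statements merged into one kernel-verified Lean document; each statement's English description precedes it below -/
import Mathlib

section
/- For an object X ∈ D^b(𝒵), Φ(X) is isomorphic to an object of 𝒜 (that is, H^j(Φ(X)) = 0 for all j ≠ 0) if and only if H^j(X) = 0 for all j ∉ {-1, 0}, H^{-1}(X) ∈ X_1 and H^0(X) ∈ X_0. In other words, Ψ(𝒜) is the tilt of 𝒵 with respect to the torsion pair (X_0, X_1). -/
open CategoryTheory Limits Abelian

namespace TorsionPairs

universe w w' v u v' u'

variable {C : Type u} [Category.{v} C] [Abelian C]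

/-- `f : X ⟶ Y` and `g : Y ⟶ Z` form a short exact sequence `0 ⟶ X ⟶ Y ⟶ Z ⟶ 0` in `C`. -/
def IsShortExactSeq {X Y Z : C} (f : X ⟶ Y) (g : Y ⟶ Z) : Prop :=
  ∃ w : f ≫ g = 0, (ShortComplex.mk f g w).ShortExact

/-- The right perpendicular class `𝒱°` of a class of objects `𝒱` (given as a predicate):
the objects `E` with `Hom(V, E) = 0` for all `V ∈ 𝒱`. -/
def Perp (P : C → Prop) : C → Prop := fun E => ∀ (V : C), P V → ∀ f : V ⟶ E, f = 0

/-- A class of objects is closed under quotient objects. -/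
def ClosedUnderQuotients (P : C → Prop) : Prop :=
  ∀ ⦃X Q : C⦄ (p : X ⟶ Q), Epi p → P X → P Q

/-- A class of objects is closed under extensions. -/
def ClosedUnderExt (P : C → Prop) : Prop :=
  ∀ ⦃X E Y : C⦄ (f : X ⟶ E) (g : E ⟶ Y), IsShortExactSeq f g → P X → P Y → P E

/-- `(T, F)` is a torsion pair in the abelian category `C`: `Hom(X, Y) = 0` whenever
`T X` and `F Y`, and every object `E` fits into a short exact sequence
`0 ⟶ X ⟶ E ⟶ Y ⟶ 0` with `T X` and `F Y`. -/
def IsTorsionPair (T F : C → Prop) : Prop :=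
  (∀ (X Y : C), T X → F Y → ∀ f : X ⟶ Y, f = 0) ∧
  (∀ E : C, ∃ (X Y : C) (f : X ⟶ E) (g : E ⟶ Y), T X ∧ F Y ∧ IsShortExactSeq f g)

/-- The extension closure of a class of objects: the smallest class of objects containing
the zero objects and the given class, and closed under extensions. -/
inductive ExtClosure (P : C → Prop) : C → Prop
  | zero (X : C) (hX : IsZero X) : ExtClosure P X
  | of (X : C) (hX : P X) : ExtClosure P X
  | ext {X E Y : C} (f : X ⟶ E) (g : E ⟶ Y) (h : IsShortExactSeq f g)
      (hX : ExtClosure P X) (hY : ExtClosure P Y) : ExtClosure P E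

/-- The class of quotient objects of objects of `S`. -/
def QuotClass (S : C → Prop) : C → Prop := fun E => ∃ (E' : C) (p : E' ⟶ E), Epi p ∧ S E'

/-- `[S]`: the extension closure of the class of quotient objects of objects of `S`. -/
def ExtClosQuot (S : C → Prop) : C → Prop := ExtClosure (QuotClass S)

variable {Z : Type u} [Category.{v} Z] [Abelian Z] [HasDerivedCategory.{w} Z]
variable {A : Type u'} [Category.{v'} A] [Abelian A] [HasDerivedCategory.{w'} A]

/-- `Φ^i(E) := H^i(Φ(E)) ∈ 𝒜`, for `E ∈ 𝒵` and an equivalence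
`Φ : D(𝒵) ≌ D(𝒜)` of derived categories. -/
noncomputable def PhiH (Φ : DerivedCategory Z ≌ DerivedCategory A) (i : ℤ) (E : Z) : A :=
  (DerivedCategory.homologyFunctor A i).obj
    (Φ.functor.obj ((DerivedCategory.singleFunctor Z 0).obj E))

/-- `Ψ^j(M) := H^j(Ψ(M)) ∈ 𝒵`, for `M ∈ 𝒜`, where `Ψ` is the quasi-inverse of `Φ`. -/
noncomputable def PsiH (Φ : DerivedCategory Z ≌ DerivedCategory A) (j : ℤ) (M : A) : Z :=
  (DerivedCategory.homologyFunctor Z j).obj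
    (Φ.inverse.obj ((DerivedCategory.singleFunctor A 0).obj M))

/-- `X_i := {E ∈ 𝒵 : Φ^j(E) = 0 for all j ≠ i}`. -/
def XClass (Φ : DerivedCategory Z ≌ DerivedCategory A) (i : ℤ) : Z → Prop :=
  fun E => ∀ j : ℤ, j ≠ i → IsZero (PhiH Φ j E)

/-- `B_i := {E ∈ 𝒵 : Φ^i(E) = 0}`. -/
def BClassD (Φ : DerivedCategory Z ≌ DerivedCategory A) (i : ℤ) : Z → Prop :=
  fun E => IsZero (PhiH Φ i E)

/-- `Y_i := {M ∈ 𝒜 : Ψ^j(M) = 0 for all j ≠ i}`. -/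
def YClass (Φ : DerivedCategory Z ≌ DerivedCategory A) (i : ℤ) : A → Prop :=
  fun M => ∀ j : ℤ, j ≠ i → IsZero (PsiH Φ j M)

/-- `C_i := {M ∈ 𝒜 : Ψ^i(M) = 0}`. -/
def CClass (Φ : DerivedCategory Z ≌ DerivedCategory A) (i : ℤ) : A → Prop :=
  fun M => IsZero (PsiH Φ i M)

/-- `K_0`: the class of cokernels of monomorphisms from objects of `X_2` to objects of
`X_0`, i.e. objects `E` fitting in a short exact sequence `0 → A → B → E → 0` with
`A ∈ X_2` and `B ∈ X_0`. -/
def K0Class (Φ : DerivedCategory Z ≌ DerivedCategory A) : Z → Prop :=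
  fun E => ∃ (A' B' : Z) (f : A' ⟶ B') (g : B' ⟶ E),
    XClass Φ 2 A' ∧ XClass Φ 0 B' ∧ IsShortExactSeq f g

/-- `K_2`: the class of kernels of epimorphisms from objects of `X_2` onto objects of
`X_0`, i.e. objects `E` fitting in a short exact sequence `0 → E → A → B → 0` with
`A ∈ X_2` and `B ∈ X_0`. -/
def K2Class (Φ : DerivedCategory Z ≌ DerivedCategory A) : Z → Prop :=
  fun E => ∃ (A' B' : Z) (f : E ⟶ A') (g : A' ⟶ B'),
    XClass Φ 2 A' ∧ XClass Φ 0 B' ∧ IsShortExactSeq f g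

/-- An object with cohomology only in degree `n` is the single object on that cohomology. -/
lemma nonempty_iso_single (X : DerivedCategory Z) (n : ℤ)
    (h : ∀ j : ℤ, j ≠ n → IsZero ((DerivedCategory.homologyFunctor Z j).obj X)) :
    Nonempty (X ≅ (DerivedCategory.singleFunctor Z n).obj
      ((DerivedCategory.homologyFunctor Z n).obj X)) := by
  have h1 : X.IsGE n := by
    rw [DerivedCategory.isGE_iff]; intro i hi; exact h i (by lia)
  have h2 : X.IsLE n := by
    rw [DerivedCategory.isLE_iff]; intro i hi; exact h i (by lia)
  obtain ⟨Y, ⟨e⟩⟩ := DerivedCategory.exists_iso_singleFunctor_obj_of_isGE_of_isLE X n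
  have e' : (DerivedCategory.homologyFunctor Z n).obj X ≅ Y :=
    (DerivedCategory.homologyFunctor Z n).mapIso e ≪≫
    (DerivedCategory.homologyFunctorFactors Z n).app
      ((HomologicalComplex.single Z (ComplexShape.up ℤ) n).obj Y) ≪≫
    (HomologicalComplex.homologyFunctorSingleIso Z (ComplexShape.up ℤ) n).app Y
  exact ⟨e ≪≫ (DerivedCategory.singleFunctor Z n).mapIso e'.symm⟩

/-- The shift isomorphism on homology objects. -/
lemma nonempty_homology_shift (X : DerivedCategory A) (n a a' : ℤ) (h : n + a = a') :
    Nonempty ((DerivedCategory.homologyFunctor A a).obj (X⟦n⟧) ≅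
      (DerivedCategory.homologyFunctor A a').obj X) :=
  ⟨((DerivedCategory.homologyFunctor A 0).shiftIso n a a' h).app X⟩

/-- The homology of `Φ(X)` for `X` concentrated in degree `n`. -/
lemma isZero_phi_iff (Φ : DerivedCategory Z ≌ DerivedCategory A)
    [Φ.functor.CommShift ℤ] (X : DerivedCategory Z) (n : ℤ) (E : Z)
    (h : ∀ j : ℤ, j ≠ n → IsZero ((DerivedCategory.homologyFunctor Z j).obj X))
    (e : (DerivedCategory.homologyFunctor Z n).obj X ≅ E) (k l : ℤ) (hk : n + l = k) :
    IsZero ((DerivedCategory.homologyFunctor A k).obj (Φ.functor.obj X)) ↔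
      IsZero (PhiH Φ l E) := by
  obtain ⟨e₁⟩ := nonempty_iso_single X n h
  have e₂ : X⟦n⟧ ≅ (DerivedCategory.singleFunctor Z 0).obj E :=
    (shiftFunctor _ n).mapIso (e₁ ≪≫ (DerivedCategory.singleFunctor Z n).mapIso e) ≪≫
      ((DerivedCategory.singleFunctors Z).shiftIso n 0 n (by simp)).app E
  obtain ⟨e₃⟩ := nonempty_homology_shift (Φ.functor.obj X) n l k hk
  exact (e₃.symm ≪≫ (DerivedCategory.homologyFunctor A l).mapIso
    ((Φ.functor.commShiftIso n).symm.app X ≪≫ Φ.functor.mapIso e₂)).isZero_iff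

/-- The truncation triangle of an object with cohomology in degrees `-1` and `0`. -/
lemma exists_trunc (X : DerivedCategory Z)
    (h : ∀ j : ℤ, j ≠ -1 → j ≠ 0 → IsZero ((DerivedCategory.homologyFunctor Z j).obj X)) :
    ∃ T ∈ Pretriangulated.distinguishedTriangles (C := DerivedCategory Z), T.obj₂ = X ∧
      (∀ j : ℤ, j ≠ -1 → IsZero ((DerivedCategory.homologyFunctor Z j).obj T.obj₁)) ∧
      (∀ j : ℤ, j ≠ 0 → IsZero ((DerivedCategory.homologyFunctor Z j).obj T.obj₃)) ∧
      Nonempty ((DerivedCategory.homologyFunctor Z (-1)).obj T.obj₁ ≅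
        (DerivedCategory.homologyFunctor Z (-1)).obj X) ∧
      Nonempty ((DerivedCategory.homologyFunctor Z 0).obj T.obj₃ ≅
        (DerivedCategory.homologyFunctor Z 0).obj X) := by
  obtain ⟨U, V, hU, hV, f, g, δ, hT⟩ :=
    DerivedCategory.TStructure.t.exists_triangle X (-1) 0 (by simp)
  have hU' : ∀ j : ℤ, -1 < j → IsZero ((DerivedCategory.homologyFunctor Z j).obj U) :=
    (DerivedCategory.isLE_iff U (-1)).1 ⟨hU⟩
  have hV' : ∀ j : ℤ, j < 0 → IsZero ((DerivedCategory.homologyFunctor Z j).obj V) :=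
    (DerivedCategory.isGE_iff V 0).1 ⟨hV⟩
  refine ⟨_, hT, rfl, ?_, ?_, ?_, ?_⟩
  · intro j hj
    by_cases hj' : -1 < j
    · exact hU' j hj'
    · exact (DerivedCategory.HomologySequence.exact₁ _ hT (j - 1) j (by lia)).isZero_X₂
        ((hV' (j - 1) (by lia)).eq_of_src _ _) ((h j hj (by lia)).eq_of_tgt _ _)
  · intro j hj
    by_cases hj' : j < 0
    · exact hV' j hj'
    · exact (DerivedCategory.HomologySequence.exact₃ _ hT j (j + 1) (by lia)).isZero_X₂
        ((h j (by lia) hj).eq_of_src _ _) ((hU' (j + 1) (by lia)).eq_of_tgt _ _)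
  · have h1 := (DerivedCategory.HomologySequence.mono_homologyMap_mor₁_iff _ hT (-2) (-1)
      (by lia)).2 ((hV' (-2) (by lia)).eq_of_src _ _)
    have h2 := (DerivedCategory.HomologySequence.epi_homologyMap_mor₁_iff _ hT (-1)).2
      ((hV' (-1) (by lia)).eq_of_tgt _ _)
    have h3 := isIso_of_mono_of_epi ((DerivedCategory.homologyFunctor Z (-1)).map
      (Pretriangulated.Triangle.mk f g δ).mor₁)
    exact ⟨@asIso _ _ _ _ _ h3⟩
  · have h1 := (DerivedCategory.HomologySequence.mono_homologyMap_mor₂_iff _ hT 0).2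
      ((hU' 0 (by lia)).eq_of_src _ _)
    have h2 := (DerivedCategory.HomologySequence.epi_homologyMap_mor₂_iff _ hT 0 1 (by lia)).2
      ((hU' 1 (by lia)).eq_of_tgt _ _)
    have h3 := isIso_of_mono_of_epi ((DerivedCategory.homologyFunctor Z 0).map
      (Pretriangulated.Triangle.mk f g δ).mor₂)
    exact ⟨(asIso ((DerivedCategory.homologyFunctor Z 0).map
      (Pretriangulated.Triangle.mk f g δ).mor₂)).symm⟩

/-- Assume `Φ^j(E) = 0` for `j ∉ [0,1]` and `Ψ^j(M) = 0` for `j ∉ [-1,0]`.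
For `X ∈ D^b(𝒵)`, `Φ(X)` is isomorphic to an object of `𝒜` (i.e. `H^j(Φ(X)) = 0` for all
`j ≠ 0`) iff `H^j(X) = 0` for `j ∉ {-1,0}`, `H⁻¹(X) ∈ X₁` and `H⁰(X) ∈ X₀`; in other
words, `Ψ(𝒜)` is the tilt of `𝒵` with respect to the torsion pair `(X₀, X₁)`. -/
theorem phi_obj_in_heart_iff
    (Φ : DerivedCategory Z ≌ DerivedCategory A)
    [Φ.functor.CommShift ℤ] [Φ.functor.IsTriangulated]
    (hΦ : ∀ (E : Z) (j : ℤ), j < 0 ∨ 1 < j → IsZero (PhiH Φ j E))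
    (hΨ : ∀ (M : A) (j : ℤ), j < -1 ∨ 0 < j → IsZero (PsiH Φ j M)) :
    ∀ X : DerivedCategory Z,
      (∃ a b : ℤ, ∀ j : ℤ, j < a ∨ b < j →
        IsZero ((DerivedCategory.homologyFunctor Z j).obj X)) →
      ((∀ j : ℤ, j ≠ 0 →
          IsZero ((DerivedCategory.homologyFunctor A j).obj (Φ.functor.obj X))) ↔
        ((∀ j : ℤ, j ≠ -1 → j ≠ 0 →
            IsZero ((DerivedCategory.homologyFunctor Z j).obj X)) ∧
          XClass Φ 1 ((DerivedCategory.homologyFunctor Z (-1)).obj X) ∧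
          XClass Φ 0 ((DerivedCategory.homologyFunctor Z 0).obj X))) := by
  intro X _
  -- the vanishing of the cohomology of `X` outside `-1, 0`
  have key : (∀ j : ℤ, j ≠ 0 →
      IsZero ((DerivedCategory.homologyFunctor A j).obj (Φ.functor.obj X))) →
      ∀ j : ℤ, j ≠ -1 → j ≠ 0 → IsZero ((DerivedCategory.homologyFunctor Z j).obj X) := by
    intro h j h1 h2
    obtain ⟨e⟩ := nonempty_iso_single (Φ.functor.obj X) 0 h
    exact (hΨ _ j (by lia)).of_iso ((DerivedCategory.homologyFunctor Z j).mapIso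
      (Φ.unitIso.app X ≪≫ Φ.inverse.mapIso e))
  suffices H : (∀ j : ℤ, j ≠ -1 → j ≠ 0 →
      IsZero ((DerivedCategory.homologyFunctor Z j).obj X)) →
      ((∀ j : ℤ, j ≠ 0 →
          IsZero ((DerivedCategory.homologyFunctor A j).obj (Φ.functor.obj X))) ↔
        (XClass Φ 1 ((DerivedCategory.homologyFunctor Z (-1)).obj X) ∧
          XClass Φ 0 ((DerivedCategory.homologyFunctor Z 0).obj X))) from
    ⟨fun h => ⟨key h, (H (key h)).1 h⟩, fun h => (H h.1).2 h.2⟩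
  intro hX
  obtain ⟨T, hT, rfl, hU, hV, ⟨eU⟩, ⟨eV⟩⟩ := exists_trunc X hX
  have hT' := Φ.functor.map_distinguished T hT
  have ex₁ := fun j => DerivedCategory.HomologySequence.exact₁ _ hT' (j - 1) j (by lia)
  have ex₂ := fun j => DerivedCategory.HomologySequence.exact₂ _ hT' j
  have ex₃ := fun j => DerivedCategory.HomologySequence.exact₃ _ hT' j (j + 1) (by lia)
  have zU := fun k => isZero_phi_iff Φ T.obj₁ (-1) _ hU eU k (k + 1) (by lia)
  have zV := fun k => isZero_phi_iff Φ T.obj₃ 0 _ hV eV k k (by lia)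
  constructor
  · intro h
    constructor
    · intro j hj
      by_cases hj0 : j = 0
      · subst hj0
        refine (zU (-1)).1 ((ex₁ (-1)).isZero_X₂ (IsZero.eq_of_src ?_ _ _)
          (IsZero.eq_of_tgt ?_ _ _))
        · exact (zV _).2 (hΦ _ _ (by lia))
        · exact h (-1) (by lia)
      · exact hΦ _ _ (by lia)
    · intro j hj
      by_cases hj1 : j = 1
      · subst hj1
        refine (zV 1).1 ((ex₃ 1).isZero_X₂ (IsZero.eq_of_src ?_ _ _)
          (IsZero.eq_of_tgt ?_ _ _))
        · exact h 1 (by lia)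
        · exact (zU _).2 (hΦ _ _ (by lia))
      · exact hΦ _ _ (by lia)
  · rintro ⟨h1, h0⟩ j hj
    refine (ex₂ j).isZero_X₂ (IsZero.eq_of_src ?_ _ _) (IsZero.eq_of_tgt ?_ _ _)
    · exact (zU j).2 (h1 _ (by lia))
    · exact (zV j).2 (h0 _ hj)

end TorsionPairs
end

section
/- For every object E ∈ 𝒵, one has Φ^0(E) ∈ Y_0 and Φ^2(E) ∈ Y_{-2}. Moreover, if Φ^0(E) = 0 then Ψ^{-2}(Φ^1(E)) = 0. -/
open CategoryTheory Limits Abelian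

namespace TorsionPairs

universe w w' v u v' u'

variable {C : Type u} [Category.{v} C] [Abelian C]

variable {Z : Type u} [Category.{v} Z] [Abelian Z] [HasDerivedCategory.{w} Z]
variable {A : Type u'} [Category.{v'} A] [Abelian A] [HasDerivedCategory.{w'} A]

section

variable [HasDerivedCategory.{w} C]

open Pretriangulated Triangulated DerivedCategory in
lemma tri_zero₁ {T : Triangle (DerivedCategory C)} (hT : T ∈ distTriang _)
    (j k : ℤ) (hk : k + 1 = j)
    (h3 : IsZero ((homologyFunctor C k).obj T.obj₃))
    (h2 : IsZero ((homologyFunctor C j).obj T.obj₂)) :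
    IsZero ((homologyFunctor C j).obj T.obj₁) :=
  (HomologySequence.exact₁ T hT k j hk).isZero_of_both_zeros
    (h3.eq_of_src _ _) (h2.eq_of_tgt _ _)

open Pretriangulated Triangulated DerivedCategory in
lemma tri_zero₂ {T : Triangle (DerivedCategory C)} (hT : T ∈ distTriang _)
    (j : ℤ)
    (h1 : IsZero ((homologyFunctor C j).obj T.obj₁))
    (h3 : IsZero ((homologyFunctor C j).obj T.obj₃)) :
    IsZero ((homologyFunctor C j).obj T.obj₂) :=
  (HomologySequence.exact₂ T hT j).isZero_of_both_zeros
    (h1.eq_of_src _ _) (h3.eq_of_tgt _ _)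

open Pretriangulated Triangulated DerivedCategory in
lemma tri_zero₃ {T : Triangle (DerivedCategory C)} (hT : T ∈ distTriang _)
    (j k : ℤ) (hk : j + 1 = k)
    (h2 : IsZero ((homologyFunctor C j).obj T.obj₂))
    (h1 : IsZero ((homologyFunctor C k).obj T.obj₁)) :
    IsZero ((homologyFunctor C j).obj T.obj₃) :=
  (HomologySequence.exact₃ T hT j k hk).isZero_of_both_zeros
    (h2.eq_of_src _ _) (h1.eq_of_tgt _ _)

open Pretriangulated Triangulated DerivedCategory in
lemma tri_iso₁ {T : Triangle (DerivedCategory C)} (hT : T ∈ distTriang _)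
    (j k : ℤ) (hk : k + 1 = j)
    (h3 : IsZero ((homologyFunctor C k).obj T.obj₃))
    (h3' : IsZero ((homologyFunctor C j).obj T.obj₃)) :
    Nonempty ((homologyFunctor C j).obj T.obj₁ ≅ (homologyFunctor C j).obj T.obj₂) := by
  have := (HomologySequence.epi_homologyMap_mor₁_iff T hT j).2 (h3'.eq_of_tgt _ _)
  have := (HomologySequence.mono_homologyMap_mor₁_iff T hT k j hk).2 (h3.eq_of_src _ _)
  have := isIso_of_mono_of_epi ((homologyFunctor C j).map T.mor₁)
  exact ⟨asIso ((homologyFunctor C j).map T.mor₁)⟩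

open Pretriangulated Triangulated DerivedCategory in
lemma tri_iso₂ {T : Triangle (DerivedCategory C)} (hT : T ∈ distTriang _)
    (j k : ℤ) (hk : j + 1 = k)
    (h1 : IsZero ((homologyFunctor C j).obj T.obj₁))
    (h1' : IsZero ((homologyFunctor C k).obj T.obj₁)) :
    Nonempty ((homologyFunctor C j).obj T.obj₂ ≅ (homologyFunctor C j).obj T.obj₃) := by
  have := (HomologySequence.epi_homologyMap_mor₂_iff T hT j k hk).2 (h1'.eq_of_tgt _ _)
  have := (HomologySequence.mono_homologyMap_mor₂_iff T hT j).2 (h1.eq_of_src _ _)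
  have := isIso_of_mono_of_epi ((homologyFunctor C j).map T.mor₂)
  exact ⟨asIso ((homologyFunctor C j).map T.mor₂)⟩

open DerivedCategory in
lemma homology_single_iso (n : ℤ) (M : C) :
    Nonempty ((homologyFunctor C n).obj ((singleFunctor C n).obj M) ≅ M) :=
  ⟨(homologyFunctor C n).mapIso ((singleFunctorIsoCompQ C n).app M) ≪≫
    (homologyFunctorFactors C n).app _ ≪≫
    HomologicalComplex.singleObjHomologySelfIso (ComplexShape.up ℤ) n M⟩

open DerivedCategory in
lemma psi_iso (Φ : DerivedCategory Z ≌ DerivedCategory A) [Φ.inverse.CommShift ℤ]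
    (X : DerivedCategory A) (n : ℤ) (h1 : X.IsGE n) (h2 : X.IsLE n)
    (M : A) (hM : Nonempty ((homologyFunctor A n).obj X ≅ M))
    (j i : ℤ) (hi : n + j = i) :
    Nonempty ((homologyFunctor Z i).obj (Φ.inverse.obj X) ≅ PsiH Φ j M) := by
  obtain ⟨Y, ⟨e⟩⟩ := X.exists_iso_singleFunctor_obj_of_isGE_of_isLE n
  obtain ⟨s⟩ := homology_single_iso n Y
  obtain ⟨m⟩ := hM
  let y : Y ≅ M := s.symm ≪≫ (homologyFunctor A n).mapIso e.symm ≪≫ m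
  let e' : (shiftFunctor (DerivedCategory A) n).obj X ≅ (singleFunctor A 0).obj M :=
    (shiftFunctor (DerivedCategory A) n).mapIso e ≪≫
      ((singleFunctors A).shiftIso n 0 n (by simp)).app Y ≪≫ (singleFunctor A 0).mapIso y
  exact ⟨(((homologyFunctor Z 0).shiftIso n j i hi).app _).symm ≪≫
    (homologyFunctor Z j).mapIso ((Φ.inverse.commShiftIso n).symm.app X ≪≫
      Φ.inverse.mapIso e')⟩

end

/-- For every `E ∈ 𝒵`, `Φ⁰(E) ∈ Y₀` and `Φ²(E) ∈ Y₋₂`; moreover if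
`Φ⁰(E) = 0` then `Ψ⁻²(Φ¹(E)) = 0`. -/
theorem phiH_zero_mem_Y0_and_phiH_two_mem_Yneg2
    (Φ : DerivedCategory Z ≌ DerivedCategory A)
    [Φ.functor.CommShift ℤ] [Φ.functor.IsTriangulated]
    (hΦ : ∀ (E : Z) (j : ℤ), j < 0 ∨ 2 < j → IsZero (PhiH Φ j E))
    (hΨ : ∀ (M : A) (j : ℤ), j < -2 ∨ 0 < j → IsZero (PsiH Φ j M)) :
    ∀ E : Z, YClass Φ 0 (PhiH Φ 0 E) ∧ YClass Φ (-2) (PhiH Φ 2 E) ∧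
      (IsZero (PhiH Φ 0 E) → IsZero (PsiH Φ (-2) (PhiH Φ 1 E))) := by
  open DerivedCategory Pretriangulated Triangulated in
  intro E
  letI := Φ.commShiftInverse ℤ
  haveI : Φ.CommShift ℤ := Φ.commShift_of_functor ℤ
  haveI : Φ.inverse.IsTriangulated := Φ.toAdjunction.isTriangulated_rightAdjoint
  obtain ⟨X, hX⟩ : ∃ X, X = Φ.functor.obj ((singleFunctor Z 0).obj E) := ⟨_, rfl⟩
  have hXH (i : ℤ) : (homologyFunctor A i).obj X = PhiH Φ i E := by rw [hX]; rfl
  have hXz (i : ℤ) (hi : i < 0 ∨ 2 < i) : IsZero ((homologyFunctor A i).obj X) := by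
    rw [hXH]; exact hΦ E i hi
  have hE (i : ℤ) (hi : i ≠ 0) : IsZero ((homologyFunctor Z i).obj (Φ.inverse.obj X)) := by
    have : IsZero ((homologyFunctor Z i).obj ((singleFunctor Z 0).obj E)) := by
      rcases lt_or_gt_of_ne hi with h | h
      · exact isZero_of_isGE _ 0 i h
      · exact isZero_of_isLE _ 0 i h
    refine this.of_iso ((homologyFunctor Z i).mapIso ?_)
    rw [hX]
    exact (Φ.unitIso.app _).symm
  obtain ⟨P, B, hP, hB, f, g, h, hT⟩ := TStructure.t.exists_triangle X 0 1 (by lia)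
  obtain ⟨Q', D, hQ, hD, f', g', h', hT'⟩ := TStructure.t.exists_triangle B 1 2 (by lia)
  replace hP : P.IsLE 0 := ⟨hP⟩
  replace hB : B.IsGE 1 := ⟨hB⟩
  replace hQ : Q'.IsLE 1 := ⟨hQ⟩
  replace hD : D.IsGE 2 := ⟨hD⟩
  have hPG : P.IsGE 0 := (isGE_iff P 0).2 fun i hi =>
    tri_zero₁ hT i (i - 1) (by lia) (isZero_of_isGE B 1 _ (by lia)) (hXz i (by lia))
  have hBL : B.IsLE 2 := (isLE_iff B 2).2 fun i hi =>
    tri_zero₃ hT i (i + 1) (by lia) (hXz i (by lia)) (isZero_of_isLE P 0 _ (by lia))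
  have hQG : Q'.IsGE 1 := (isGE_iff Q' 1).2 fun i hi =>
    tri_zero₁ hT' i (i - 1) (by lia) (isZero_of_isGE D 2 _ (by lia))
      (isZero_of_isGE B 1 _ (by lia))
  have hDL : D.IsLE 2 := (isLE_iff D 2).2 fun i hi =>
    tri_zero₃ hT' i (i + 1) (by lia) (isZero_of_isLE B 2 _ (by lia))
      (isZero_of_isLE Q' 1 _ (by lia))
  have e0 : Nonempty ((homologyFunctor A 0).obj P ≅ PhiH Φ 0 E) := by
    rw [← hXH]
    exact tri_iso₁ hT 0 (-1) (by lia) (isZero_of_isGE B 1 _ (by lia))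
      (isZero_of_isGE B 1 _ (by lia))
  have e1 : Nonempty ((homologyFunctor A 1).obj Q' ≅ PhiH Φ 1 E) := by
    rw [← hXH]
    obtain ⟨a⟩ := tri_iso₁ hT' 1 0 (by lia) (isZero_of_isGE D 2 _ (by lia))
      (isZero_of_isGE D 2 _ (by lia))
    obtain ⟨b⟩ := tri_iso₂ hT 1 2 (by lia) (isZero_of_isLE P 0 _ (by lia))
      (isZero_of_isLE P 0 _ (by lia))
    exact ⟨a ≪≫ b.symm⟩
  have e2 : Nonempty ((homologyFunctor A 2).obj D ≅ PhiH Φ 2 E) := by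
    rw [← hXH]
    obtain ⟨a⟩ := tri_iso₂ hT' 2 3 (by lia) (isZero_of_isLE Q' 1 _ (by lia))
      (isZero_of_isLE Q' 1 _ (by lia))
    obtain ⟨b⟩ := tri_iso₂ hT 2 3 (by lia) (isZero_of_isLE P 0 _ (by lia))
      (isZero_of_isLE P 0 _ (by lia))
    exact ⟨a.symm ≪≫ b.symm⟩
  have p0 := psi_iso Φ P 0 hPG hP _ e0
  have p1 := psi_iso Φ Q' 1 hQG hQ _ e1
  have p2 := psi_iso Φ D 2 hD hDL _ e2
  have zP (i : ℤ) (hi : i < -2 ∨ 0 < i) :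
      IsZero ((homologyFunctor Z i).obj (Φ.inverse.obj P)) :=
    (hΨ _ (i - 0) (by lia)).of_iso (p0 (i - 0) i (by lia)).some
  have zQ (i : ℤ) (hi : i < -1 ∨ 1 < i) :
      IsZero ((homologyFunctor Z i).obj (Φ.inverse.obj Q')) :=
    (hΨ _ (i - 1) (by lia)).of_iso (p1 (i - 1) i (by lia)).some
  have zD (i : ℤ) (hi : i < 0 ∨ 2 < i) :
      IsZero ((homologyFunctor Z i).obj (Φ.inverse.obj D)) :=
    (hΨ _ (i - 2) (by lia)).of_iso (p2 (i - 2) i (by lia)).some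
  have S := Φ.inverse.map_distinguished _ hT
  have S' := Φ.inverse.map_distinguished _ hT'
  refine ⟨fun j hj => ?_, fun j hj => ?_, fun h0 => ?_⟩
  · by_cases hj' : j < -2 ∨ 0 < j
    · exact hΨ _ j hj'
    refine IsZero.of_iso ?_ (p0 j j (by lia)).some.symm
    exact tri_zero₁ S j (j - 1) (by lia)
      (tri_zero₂ S' (j - 1) (zQ _ (by lia)) (zD _ (by lia))) (hE j (by lia))
  · by_cases hj' : j < -2 ∨ 0 < j
    · exact hΨ _ j hj'
    refine IsZero.of_iso ?_ (p2 j (2 + j) (by lia)).some.symm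
    exact tri_zero₃ S' (2 + j) (3 + j) (by lia)
      (tri_zero₃ S (2 + j) (3 + j) (by lia) (hE _ (by lia)) (zP _ (by lia))) (zQ _ (by lia))
  · refine IsZero.of_iso ?_ (p1 (-2) (-1) (by lia)).some.symm
    have z0 : IsZero ((homologyFunctor Z 0).obj (Φ.inverse.obj P)) := by
      refine IsZero.of_iso ?_ (p0 0 0 (by lia)).some
      have : Φ.inverse.Additive := inferInstance
      exact Functor.map_isZero (homologyFunctor Z 0)
        (Functor.map_isZero Φ.inverse (Functor.map_isZero (singleFunctor A 0) h0))
    exact tri_zero₁ S' (-1) (-2) (by lia) (zD _ (by lia))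
      (tri_zero₃ S (-1) 0 (by lia) (hE _ (by lia)) z0)

end TorsionPairs
end

section
/- For every object E ∈ 𝒵 there is a filtration F^0E ⊆ F^{-1}E ⊆ E in 𝒵 such that F^0E ∈ K_0, F^{-1}E/F^0E ≅ Ψ^{-1}(Φ^1(E)), and E/F^{-1}E ∈ K_2. -/
open CategoryTheory Limits Abelian

namespace TorsionPairs

universe w w' v u v' u'

variable {C : Type u} [Category.{v} C] [Abelian C]

variable {Z : Type u} [Category.{v} Z] [Abelian Z] [HasDerivedCategory.{w} Z]
variable {A : Type u'} [Category.{v'} A] [Abelian A] [HasDerivedCategory.{w'} A]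

section Helpers

open DerivedCategory Pretriangulated

/-- Assembling the filtration from the two exact sequences. -/
lemma exists_filtration {E N B Q J R S : C} (a : N ⟶ B) (b : B ⟶ E) (c : E ⟶ Q)
    (i : J ⟶ Q) (p : Q ⟶ R) (d : R ⟶ S) [Mono a] [Epi c] [Mono i] [Epi d]
    (wab : a ≫ b = 0) (hab : (ShortComplex.mk a b wab).Exact)
    (wbc : b ≫ c = 0) (hbc : (ShortComplex.mk b c wbc).Exact)
    (wip : i ≫ p = 0) (hip : (ShortComplex.mk i p wip).Exact)
    (wpd : p ≫ d = 0) (hpd : (ShortComplex.mk p d wpd).Exact) :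
    ∃ (S₀ S₁ : Subobject E) (h : S₀ ≤ S₁),
      (∃ g : B ⟶ (S₀ : C), IsShortExactSeq a g) ∧
      Nonempty (cokernel (Subobject.ofLE S₀ S₁ h) ≅ J) ∧
      (∃ f : cokernel S₁.arrow ⟶ R, IsShortExactSeq f d) := by
  let S₀ := kernelSubobject c
  let S₁ := kernelSubobject (c ≫ p)
  have h : S₀ ≤ S₁ := le_kernelSubobject _ _ (by simp [S₀])
  have h0 : S₀.arrow ≫ c = 0 := kernelSubobject_arrow_comp c
  have h1 : S₁.arrow ≫ c ≫ p = 0 := kernelSubobject_arrow_comp (c ≫ p)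
  have e0 : (ShortComplex.mk _ _ h0).Exact := by
    rw [ShortComplex.exact_iff_exact_up_to_refinements]
    intro T x hx
    refine ⟨T, 𝟙 _, inferInstance, factorThruKernelSubobject c x hx, ?_⟩
    simp [S₀]
  have e1 : (ShortComplex.mk _ _ h1).Exact := by
    rw [ShortComplex.exact_iff_exact_up_to_refinements]
    intro T x hx
    refine ⟨T, 𝟙 _, inferInstance, factorThruKernelSubobject (c ≫ p) x hx, ?_⟩
    simp [S₁]
  refine ⟨S₀, S₁, h, ⟨factorThruKernelSubobject c b wbc, ?_⟩, ?_, ?_⟩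
  · have w : a ≫ factorThruKernelSubobject c b wbc = 0 := by
      rw [← cancel_mono (kernelSubobject c).arrow]
      simp [wab]
    refine ⟨w, ?_⟩
    have : Epi (factorThruKernelSubobject c b wbc) := by
      rw [epi_iff_surjective_up_to_refinements]
      intro T y
      obtain ⟨T', π, hπ, x, hx⟩ := hbc.exact_up_to_refinements (y ≫ S₀.arrow)
        (by simp [S₀])
      refine ⟨T', π, hπ, x, ?_⟩
      rw [← cancel_mono (kernelSubobject c).arrow]
      simpa [S₀] using hx
    refine { exact := ?_, mono_f := by dsimp; infer_instance, epi_g := by dsimp; infer_instance }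
    rw [ShortComplex.exact_iff_exact_up_to_refinements]
    intro T x hx
    refine hab.exact_up_to_refinements x ?_
    have := congrArg (· ≫ (kernelSubobject c).arrow) hx
    simpa using this
  · have wq : (S₁.arrow ≫ c) ≫ p = 0 := by simpa using h1
    have : Mono (ShortComplex.mk i p wip).f := by dsimp; infer_instance
    let q : (S₁ : C) ⟶ J := hip.lift (S₁.arrow ≫ c) wq
    have hq : q ≫ i = S₁.arrow ≫ c := hip.lift_f _ _
    have w : Subobject.ofLE S₀ S₁ h ≫ q = 0 := by
      rw [← cancel_mono i, Category.assoc, hq, Subobject.ofLE_arrow_assoc, h0, zero_comp]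
    have : Epi q := by
      rw [epi_iff_surjective_up_to_refinements]
      intro T y
      obtain ⟨T', π, hπ, x, hx⟩ := surjective_up_to_refinements_of_epi c (y ≫ i)
      have hx' : x ≫ c ≫ p = 0 := by
        rw [← reassoc_of% hx, wip, comp_zero, comp_zero]
      refine ⟨T', π, hπ, factorThruKernelSubobject (c ≫ p) x hx', ?_⟩
      rw [← cancel_mono i, Category.assoc, Category.assoc, hq]
      rw [hx, ← Category.assoc, factorThruKernelSubobject_comp_arrow]
    have ex : (ShortComplex.mk _ _ w).Exact := by
      rw [ShortComplex.exact_iff_exact_up_to_refinements]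
      intro T x hx
      have hx' : (x ≫ S₁.arrow) ≫ c = 0 := by
        rw [Category.assoc, ← hq]
        dsimp at hx
        rw [reassoc_of% hx, zero_comp]
      obtain ⟨T', π, hπ, y, hy⟩ := e0.exact_up_to_refinements _ hx'
      refine ⟨T', π, hπ, y, ?_⟩
      rw [← cancel_mono S₁.arrow]
      simpa using hy
    have : Epi (ShortComplex.mk _ _ w).g := by dsimp; infer_instance
    exact ⟨(cokernelIsCokernel _).coconePointUniqueUpToIso ex.gIsCokernel⟩
  · let f : cokernel S₁.arrow ⟶ R := cokernel.desc S₁.arrow (c ≫ p) h1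
    have hf : cokernel.π S₁.arrow ≫ f = c ≫ p := cokernel.π_desc _ _ _
    have w : f ≫ d = 0 := by
      rw [← cancel_epi (cokernel.π S₁.arrow), reassoc_of% hf, wpd, comp_zero, comp_zero]
    refine ⟨f, w, ?_⟩
    have : Mono f := e1.mono_cokernelDesc
    refine { exact := ?_, mono_f := by dsimp; infer_instance, epi_g := by dsimp; infer_instance }
    rw [ShortComplex.exact_iff_exact_up_to_refinements]
    intro T x hx
    obtain ⟨T', π, hπ, y, hy⟩ := hpd.exact_up_to_refinements x hx
    obtain ⟨T'', π', hπ', z, hz⟩ := surjective_up_to_refinements_of_epi c y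
    refine ⟨T'', π' ≫ π, inferInstance, z ≫ cokernel.π S₁.arrow, ?_⟩
    dsimp at hy ⊢
    rw [Category.assoc, Category.assoc, hf, hy, reassoc_of% hz]

lemma exists_filtration_of_iso {E E' N B Q J R S : C} (e : E ≅ E')
    (a : N ⟶ B) (b : B ⟶ E') (c : E' ⟶ Q)
    (i : J ⟶ Q) (p : Q ⟶ R) (d : R ⟶ S) (_ : Mono a) (_ : Epi c) (_ : Mono i) (_ : Epi d)
    (wab : a ≫ b = 0) (hab : (ShortComplex.mk a b wab).Exact)
    (wbc : b ≫ c = 0) (hbc : (ShortComplex.mk b c wbc).Exact)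
    (wip : i ≫ p = 0) (hip : (ShortComplex.mk i p wip).Exact)
    (wpd : p ≫ d = 0) (hpd : (ShortComplex.mk p d wpd).Exact) :
    ∃ (S₀ S₁ : Subobject E) (h : S₀ ≤ S₁),
      (∃ g : B ⟶ (S₀ : C), IsShortExactSeq a g) ∧
      Nonempty (cokernel (Subobject.ofLE S₀ S₁ h) ≅ J) ∧
      (∃ f : cokernel S₁.arrow ⟶ R, IsShortExactSeq f d) :=
  exists_filtration a (b ≫ e.inv) (e.hom ≫ c) i p d
    (by rw [← Category.assoc, wab, zero_comp])
    (ShortComplex.exact_of_iso (S₁ := ShortComplex.mk a b wab)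
      (ShortComplex.isoMk (Iso.refl _) (Iso.refl _) e.symm
      (by simp) (by simp)) hab)
    (by simp [wbc])
    (ShortComplex.exact_of_iso (S₁ := ShortComplex.mk b c wbc)
      (ShortComplex.isoMk (Iso.refl _) e.symm (Iso.refl _)
      (by simp) (by simp)) hbc) wip hip wpd hpd

variable [HasDerivedCategory.{w} C]

lemma exists_trunc_s16 (K : DerivedCategory C) (a b : ℤ) (h : a + 1 = b) :
    ∃ (X Y : DerivedCategory C) (f : X ⟶ K) (g : K ⟶ Y) (δ : Y ⟶ X⟦(1 : ℤ)⟧),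
      Triangle.mk f g δ ∈ distTriang _ ∧ X.IsLE a ∧ Y.IsGE b ∧
      (∀ n, K.IsLE n → Y.IsLE n) ∧ (∀ n, K.IsGE n → X.IsGE n) := by
  let t := (TStructure.t : Triangulated.TStructure (DerivedCategory C))
  refine ⟨(t.truncLE a).obj K, (t.truncGE b).obj K, _, _, _,
    t.triangleLEGE_distinguished a b h K, ?_, ?_, ?_, ?_⟩
  · change t.IsLE _ _
    infer_instance
  · change t.IsGE _ _
    infer_instance
  · intro n hn
    have : t.IsLE K n := hn
    change t.IsLE _ _
    infer_instance
  · intro n hn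
    have : t.IsGE K n := hn
    change t.IsGE _ _
    infer_instance

lemma nonempty_iso_single_s16 (K : DerivedCategory C) (n : ℤ) (h₁ : K.IsGE n) (h₂ : K.IsLE n) :
    Nonempty (K ≅ (singleFunctor C n).obj ((homologyFunctor C n).obj K)) := by
  obtain ⟨Y, ⟨e⟩⟩ := exists_iso_singleFunctor_obj_of_isGE_of_isLE K n
  exact ⟨e ≪≫ (singleFunctor C n).mapIso
    (((homologyFunctor C n).mapIso e ≪≫ (singleFunctorCompHomologyFunctorIso C n).app Y).symm)⟩

lemma isIso_H_mor₂ (T : Triangle (DerivedCategory C)) (hT : T ∈ distTriang _) (n m : ℤ)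
    (h : n + 1 = m)
    (h₁ : IsZero ((homologyFunctor C n).obj T.obj₁))
    (h₂ : IsZero ((homologyFunctor C m).obj T.obj₁)) :
    IsIso ((homologyFunctor C n).map T.mor₂) := by
  have := (HomologySequence.mono_homologyMap_mor₂_iff T hT n).2 (h₁.eq_zero_of_src _)
  have := (HomologySequence.epi_homologyMap_mor₂_iff T hT n m h).2 (h₂.eq_zero_of_tgt _)
  exact isIso_of_mono_of_epi _

lemma isIso_H_mor₁ (T : Triangle (DerivedCategory C)) (hT : T ∈ distTriang _) (n m : ℤ)
    (h : n + 1 = m)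
    (h₁ : IsZero ((homologyFunctor C n).obj T.obj₃))
    (h₂ : IsZero ((homologyFunctor C m).obj T.obj₃)) :
    IsIso ((homologyFunctor C m).map T.mor₁) := by
  have := (HomologySequence.mono_homologyMap_mor₁_iff T hT n m h).2 (h₁.eq_zero_of_src _)
  have := (HomologySequence.epi_homologyMap_mor₁_iff T hT m).2 (h₂.eq_zero_of_tgt _)
  exact isIso_of_mono_of_epi _

variable {D : Type u'} [Category.{v'} D] [Abelian D] [HasDerivedCategory.{w'} D]

lemma nonempty_H_single (F : DerivedCategory C ⥤ DerivedCategory D) [F.CommShift ℤ]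
    (Y : C) (n j k : ℤ) (h : k + n = j) :
    Nonempty ((homologyFunctor D j).obj (F.obj ((singleFunctor C n).obj Y)) ≅
      (homologyFunctor D k).obj (F.obj ((singleFunctor C 0).obj Y))) := by
  have e₁ : (singleFunctor C n).obj Y ≅ ((singleFunctor C 0).obj Y)⟦-n⟧ :=
    (((singleFunctors C).shiftIso (-n) n 0 (by lia)).app Y).symm
  have e₂ := (F.commShiftIso (-n)).app ((singleFunctor C 0).obj Y)
  have e₃ := ((homologyFunctor D 0).shiftIso (-n) j k (by lia)).app
    (F.obj ((singleFunctor C 0).obj Y))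
  exact ⟨(homologyFunctor D j).mapIso (F.mapIso e₁ ≪≫ e₂) ≪≫ e₃⟩

/-- The amplitude condition on single objects. -/
def Ampl (F : DerivedCategory C ⥤ DerivedCategory D) (a b : ℤ) : Prop :=
  ∀ (Y : C) (j : ℤ), j < a ∨ b < j →
    IsZero ((homologyFunctor D j).obj (F.obj ((singleFunctor C 0).obj Y)))

lemma Ampl.zero_one {F : DerivedCategory C ⥤ DerivedCategory D} [F.CommShift ℤ] {a b : ℤ}
    (hF : Ampl F a b) (K : DerivedCategory C) (n : ℤ) (h₁ : K.IsGE n) (h₂ : K.IsLE n)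
    (j : ℤ) (hj : j < a + n ∨ b + n < j) : IsZero ((homologyFunctor D j).obj (F.obj K)) := by
  obtain ⟨e⟩ := nonempty_iso_single_s16 K n h₁ h₂
  obtain ⟨e'⟩ := nonempty_H_single F ((homologyFunctor C n).obj K) n j (j - n) (by lia)
  exact (hF _ (j - n) (by lia)).of_iso ((homologyFunctor D j).mapIso (F.mapIso e) ≪≫ e')

lemma Ampl.zero_two {F : DerivedCategory C ⥤ DerivedCategory D} [F.CommShift ℤ]
    [F.IsTriangulated] {a b : ℤ}
    (hF : Ampl F a b) (K : DerivedCategory C) (n m : ℤ) (h : n + 1 = m)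
    (h₁ : K.IsGE n) (h₂ : K.IsLE m)
    (j : ℤ) (hj : j < a + n ∨ b + m < j) : IsZero ((homologyFunctor D j).obj (F.obj K)) := by
  obtain ⟨X, Y, f, g, δ, hT, hX, hY, hY', hX'⟩ := exists_trunc_s16 K n m h
  have hT' := F.map_distinguished _ hT
  refine (HomologySequence.exact₂ _ hT' j).isZero_of_both_isZero ?_ ?_
  · exact hF.zero_one X n (hX' _ h₁) hX j (by lia)
  · exact hF.zero_one Y m hY (hY' _ h₂) j (by lia)

lemma single_H_zero (Y : C) (j : ℤ) (hj : j ≠ 0) :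
    IsZero ((homologyFunctor C j).obj ((singleFunctor C 0).obj Y)) := by
  rcases lt_or_gt_of_ne hj with h | h
  · exact isZero_of_isGE _ 0 j h
  · exact isZero_of_isLE _ 0 j h

/-- `H⁰` of an object of amplitude `[-2,0]` lies in `X₀`. -/
lemma top_mem (F : DerivedCategory C ⥤ DerivedCategory D) [F.CommShift ℤ]
    [F.IsTriangulated] (hF : Ampl F 0 2) (L : DerivedCategory C)
    (h₁ : L.IsGE (-2)) (h₂ : L.IsLE 0)
    (hL : ∀ j : ℤ, j ≠ 0 → IsZero ((homologyFunctor D j).obj (F.obj L))) (j : ℤ) (hj : j ≠ 0) :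
    IsZero ((homologyFunctor D j).obj (F.obj
      ((singleFunctor C 0).obj ((homologyFunctor C 0).obj L)))) := by
  by_cases hj' : j < 0
  · exact hF _ _ (Or.inl hj')
  obtain ⟨X, Y, f, g, δ, hT, hX, hY, hY', hX'⟩ := exists_trunc_s16 L (-1) 0 (by lia)
  have hi : IsIso ((homologyFunctor C 0).map g) :=
    isIso_H_mor₂ _ hT 0 1 (by lia) (isZero_of_isLE X (-1) 0 (by lia))
      (isZero_of_isLE X (-1) 1 (by lia))
  obtain ⟨e⟩ := nonempty_iso_single_s16 Y 0 hY (hY' _ h₂)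
  have hT' := F.map_distinguished _ hT
  have : IsZero ((homologyFunctor D j).obj (F.obj Y)) := by
    refine (HomologySequence.exact₃ _ hT' j (j + 1) rfl).isZero_of_both_isZero (hL j hj) ?_
    exact hF.zero_two X (-2) (-1) (by lia) (hX' _ h₁) hX (j + 1) (by lia)
  exact this.of_iso ((homologyFunctor D j).mapIso (F.mapIso
    ((singleFunctor C 0).mapIso (asIso ((homologyFunctor C 0).map g)) ≪≫ e.symm)))

/-- `H⁻²` of an object of amplitude `[-2,0]` lies in `X₂`. -/
lemma bot_mem (F : DerivedCategory C ⥤ DerivedCategory D) [F.CommShift ℤ]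
    [F.IsTriangulated] (hF : Ampl F 0 2) (L : DerivedCategory C)
    (h₁ : L.IsGE (-2)) (h₂ : L.IsLE 0)
    (hL : ∀ j : ℤ, j ≠ 0 → IsZero ((homologyFunctor D j).obj (F.obj L))) (j : ℤ) (hj : j ≠ 2) :
    IsZero ((homologyFunctor D j).obj (F.obj
      ((singleFunctor C 0).obj ((homologyFunctor C (-2)).obj L)))) := by
  by_cases hj' : 2 < j
  · exact hF _ _ (Or.inr hj')
  obtain ⟨X, Y, f, g, δ, hT, hX, hY, hY', hX'⟩ := exists_trunc_s16 L (-2) (-1) (by lia)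
  have hi : IsIso ((homologyFunctor C (-2)).map f) :=
    isIso_H_mor₁ _ hT (-3) (-2) (by lia) (isZero_of_isGE Y (-1) (-3) (by lia))
      (isZero_of_isGE Y (-1) (-2) (by lia))
  obtain ⟨e⟩ := nonempty_iso_single_s16 X (-2) (hX' _ h₁) hX
  have hT' := F.map_distinguished _ hT
  have : IsZero ((homologyFunctor D (j - 2)).obj (F.obj X)) := by
    refine (HomologySequence.exact₁ _ hT' (j - 3) (j - 2) (by lia)).isZero_of_both_isZero ?_
      (hL (j - 2) (by lia))
    exact hF.zero_two Y (-1) 0 (by lia) hY (hY' _ h₂) (j - 3) (by lia)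
  obtain ⟨e'⟩ := nonempty_H_single F ((homologyFunctor C (-2)).obj L) (-2) (j - 2) j (by lia)
  exact this.of_iso (e'.symm ≪≫ (homologyFunctor D (j - 2)).mapIso (F.mapIso
    ((singleFunctor C (-2)).mapIso (asIso ((homologyFunctor C (-2)).map f)).symm ≪≫ e.symm)))

lemma XClass_of_iso (Φ : DerivedCategory Z ≌ DerivedCategory A) (i : ℤ) {E E' : Z}
    (e : E ≅ E') (h : XClass Φ i E) : XClass Φ i E' := fun j hj =>
  (h j hj).of_iso ((homologyFunctor A j).mapIso (Φ.functor.mapIso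
    ((singleFunctor Z 0).mapIso e.symm)))

section

variable (Φ : DerivedCategory Z ≌ DerivedCategory A)
    [Φ.functor.CommShift ℤ] [Φ.functor.IsTriangulated]

lemma X0_PsiH
    (hΦ : ∀ (E : Z) (j : ℤ), j < 0 ∨ 2 < j → IsZero (PhiH Φ j E))
    (hΨ : ∀ (M : A) (j : ℤ), j < -2 ∨ 0 < j → IsZero (PsiH Φ j M))
    (M : A) : XClass Φ 0 (PsiH Φ 0 M) := by
  intro j hj
  refine top_mem Φ.functor hΦ (Φ.inverse.obj ((singleFunctor A 0).obj M)) ?_ ?_ ?_ j hj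
  · rw [isGE_iff]
    exact fun i hi => hΨ M i (Or.inl hi)
  · rw [isLE_iff]
    exact fun i hi => hΨ M i (Or.inr hi)
  · intro j hj
    exact (single_H_zero M j hj).of_iso ((homologyFunctor A j).mapIso (Φ.counitIso.app _))

lemma X2_PsiH
    (hΦ : ∀ (E : Z) (j : ℤ), j < 0 ∨ 2 < j → IsZero (PhiH Φ j E))
    (hΨ : ∀ (M : A) (j : ℤ), j < -2 ∨ 0 < j → IsZero (PsiH Φ j M))
    (M : A) : XClass Φ 2 (PsiH Φ (-2) M) := by
  intro j hj
  refine bot_mem Φ.functor hΦ (Φ.inverse.obj ((singleFunctor A 0).obj M)) ?_ ?_ ?_ j hj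
  · rw [isGE_iff]
    exact fun i hi => hΨ M i (Or.inl hi)
  · rw [isLE_iff]
    exact fun i hi => hΨ M i (Or.inr hi)
  · intro j hj
    exact (single_H_zero M j hj).of_iso ((homologyFunctor A j).mapIso (Φ.counitIso.app _))

end

end Helpers

/-- For every `E ∈ 𝒵` there is a filtration `F⁰E ⊆ F⁻¹E ⊆ E` with
`F⁰E ∈ K₀`, `F⁻¹E/F⁰E ≅ Ψ⁻¹(Φ¹(E))` and `E/F⁻¹E ∈ K₂`. -/
theorem jms_two_step_filtration
    (Φ : DerivedCategory Z ≌ DerivedCategory A)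
    [Φ.functor.CommShift ℤ] [Φ.functor.IsTriangulated]
    (hΦ : ∀ (E : Z) (j : ℤ), j < 0 ∨ 2 < j → IsZero (PhiH Φ j E))
    (hΨ : ∀ (M : A) (j : ℤ), j < -2 ∨ 0 < j → IsZero (PsiH Φ j M)) :
    ∀ E : Z, ∃ (S₀ S₁ : Subobject E) (h : S₀ ≤ S₁),
      K0Class Φ ((S₀ : Z)) ∧
      Nonempty (cokernel (Subobject.ofLE S₀ S₁ h) ≅ PsiH Φ (-1) (PhiH Φ 1 E)) ∧
      K2Class Φ (cokernel S₁.arrow) := by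
  intro E
  let := Φ.commShiftInverse ℤ
  have := Φ.commShift_of_functor ℤ
  have : Φ.inverse.IsTriangulated := Φ.toAdjunction.isTriangulated_rightAdjoint
  have hG : Ampl Φ.inverse (-2) 0 := hΨ
  let K := Φ.functor.obj ((DerivedCategory.singleFunctor Z 0).obj E)
  have hK₁ : K.IsGE 0 := (DerivedCategory.isGE_iff K 0).2 fun i hi => hΦ E i (Or.inl hi)
  have hK₂ : K.IsLE 2 := (DerivedCategory.isLE_iff K 2).2 fun i hi => hΦ E i (Or.inr hi)
  obtain ⟨X, Y, f, g, δ, hT, hX, hY, hY', hX'⟩ := exists_trunc_s16 K 0 1 (by lia)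
  obtain ⟨U, V, f', g', δ', hT', hU, hV, hV', hU'⟩ := exists_trunc_s16 Y 1 2 (by lia)
  have hX' := hX' 0 hK₁
  have hY' := hY' 2 hK₂
  have hV' := hV' 2 hY'
  have hU' := hU' 1 hY
  -- the identification of `H¹(U)` with `Φ¹(E)`
  have i₁ : IsIso ((DerivedCategory.homologyFunctor A 1).map g) :=
    isIso_H_mor₂ _ hT 1 2 (by lia) (DerivedCategory.isZero_of_isLE X 0 1 (by lia))
      (DerivedCategory.isZero_of_isLE X 0 2 (by lia))
  have i₂ : IsIso ((DerivedCategory.homologyFunctor A 1).map f') :=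
    isIso_H_mor₁ _ hT' 0 1 (by lia) (DerivedCategory.isZero_of_isGE V 2 0 (by lia))
      (DerivedCategory.isZero_of_isGE V 2 1 (by lia))
  let eU : (DerivedCategory.homologyFunctor A 1).obj U ≅ PhiH Φ 1 E :=
    asIso ((DerivedCategory.homologyFunctor A 1).map f') ≪≫
      (asIso ((DerivedCategory.homologyFunctor A 1).map g)).symm
  obtain ⟨sX⟩ := nonempty_iso_single_s16 X 0 hX' hX
  obtain ⟨sU⟩ := nonempty_iso_single_s16 U 1 hU' hU
  obtain ⟨sV⟩ := nonempty_iso_single_s16 V 2 hV hV'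
  have zE : ∀ j : ℤ, j ≠ 0 →
      IsZero ((DerivedCategory.homologyFunctor Z j).obj (Φ.inverse.obj K)) := fun j hj =>
    (single_H_zero E j hj).of_iso
      ((DerivedCategory.homologyFunctor Z j).mapIso (Φ.unitIso.app _).symm)
  have sU' : ∀ j k : ℤ, k + 1 = j →
      Nonempty ((DerivedCategory.homologyFunctor Z j).obj (Φ.inverse.obj U) ≅
        PsiH Φ k (PhiH Φ 1 E)) := fun j k h => by
    obtain ⟨e⟩ := nonempty_H_single Φ.inverse (PhiH Φ 1 E) 1 j k h
    exact ⟨(DerivedCategory.homologyFunctor Z j).mapIso (Φ.inverse.mapIso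
      (sU ≪≫ (DerivedCategory.singleFunctor A 1).mapIso eU)) ≪≫ e⟩
  have D₁ := Φ.inverse.map_distinguished _ hT
  have D₂ := Φ.inverse.map_distinguished _ hT'
  let T₁ := Φ.inverse.mapTriangle.obj (Pretriangulated.Triangle.mk f g δ)
  let T₂ := Φ.inverse.mapTriangle.obj (Pretriangulated.Triangle.mk f' g' δ')
  have zX : ∀ j : ℤ, j < -2 ∨ 0 < j →
      IsZero ((DerivedCategory.homologyFunctor Z j).obj (Φ.inverse.obj X)) := fun j hj =>
    hG.zero_one X 0 hX' hX j (by lia)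
  have zV : ∀ j : ℤ, j < 0 ∨ 2 < j →
      IsZero ((DerivedCategory.homologyFunctor Z j).obj (Φ.inverse.obj V)) := fun j hj =>
    hG.zero_one V 2 hV hV' j (by lia)
  have zY : IsZero ((DerivedCategory.homologyFunctor Z 1).obj (Φ.inverse.obj Y)) :=
    (DerivedCategory.HomologySequence.exact₃ _ D₁ 1 2 (by lia)).isZero_of_both_isZero
      (zE 1 (by lia)) (zX 2 (by lia))
  let eE : E ≅ (DerivedCategory.homologyFunctor Z 0).obj (Φ.inverse.obj K) :=
    ((DerivedCategory.singleFunctorCompHomologyFunctorIso Z 0).app E).symm ≪≫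
      (DerivedCategory.homologyFunctor Z 0).mapIso (Φ.unitIso.app _)
  let a := DerivedCategory.HomologySequence.δ T₁ (-1) 0 (by lia)
  let b₀ := (DerivedCategory.homologyFunctor Z 0).map T₁.mor₁
  let c₀ := (DerivedCategory.homologyFunctor Z 0).map T₁.mor₂
  let i := (DerivedCategory.homologyFunctor Z 0).map T₂.mor₁
  let p := (DerivedCategory.homologyFunctor Z 0).map T₂.mor₂
  let d := DerivedCategory.HomologySequence.δ T₂ 0 1 (by lia)
  have hab := DerivedCategory.HomologySequence.exact₁ T₁ D₁ (-1) 0 (by lia)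
  have hbc := DerivedCategory.HomologySequence.exact₂ T₁ D₁ 0
  have hip := DerivedCategory.HomologySequence.exact₂ T₂ D₂ 0
  have hpd := DerivedCategory.HomologySequence.exact₃ T₂ D₂ 0 1 (by lia)
  have mono_a : Mono a :=
    (DerivedCategory.HomologySequence.exact₃ T₁ D₁ (-1) 0 (by lia)).mono_g
      ((zE (-1) (by lia)).eq_zero_of_src _)
  have epi_c : Epi c₀ :=
    (DerivedCategory.HomologySequence.exact₃ T₁ D₁ 0 1 (by lia)).epi_f
      ((zX 1 (by lia)).eq_zero_of_tgt _)
  have mono_i : Mono i :=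
    (DerivedCategory.HomologySequence.exact₁ T₂ D₂ (-1) 0 (by lia)).mono_g
      ((zV (-1) (by lia)).eq_zero_of_src _)
  have epi_d : Epi d :=
    (DerivedCategory.HomologySequence.exact₁ T₂ D₂ 0 1 (by lia)).epi_f
      (zY.eq_zero_of_tgt _)
  obtain ⟨S₀, S₁, h, ⟨g₀, hg₀⟩, ⟨eJ⟩, ⟨f₁, hf₁⟩⟩ :=
    exists_filtration_of_iso eE a b₀ c₀ i p d mono_a epi_c mono_i epi_d _ hab _ hbc _ hip _ hpd
  refine ⟨S₀, S₁, h, ⟨_, _, a, g₀, ?_, ?_, hg₀⟩, ?_, ⟨_, _, f₁, d, ?_, ?_, hf₁⟩⟩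
  · -- `H⁻¹(ΨY) ≅ H⁻¹(ΨU) ≅ Ψ⁻²(Φ¹ E)`
    have hiso : IsIso ((DerivedCategory.homologyFunctor Z (-1)).map T₂.mor₁) :=
      isIso_H_mor₁ T₂ D₂ (-2) (-1) (by lia) (zV _ (by lia)) (zV _ (by lia))
    obtain ⟨e⟩ := sU' (-1) (-2) (by lia)
    let eI := @asIso _ _ _ _ ((DerivedCategory.homologyFunctor Z (-1)).map T₂.mor₁) hiso
    exact XClass_of_iso Φ 2 (e.symm ≪≫ eI) (X2_PsiH Φ hΦ hΨ _)
  · exact XClass_of_iso Φ 0 ((DerivedCategory.homologyFunctor Z 0).mapIso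
      (Φ.inverse.mapIso sX.symm)) (X0_PsiH Φ hΦ hΨ _)
  · obtain ⟨e⟩ := sU' 0 (-1) (by lia)
    exact ⟨eJ ≪≫ e⟩
  · obtain ⟨e⟩ := nonempty_H_single Φ.inverse
      ((DerivedCategory.homologyFunctor A 2).obj V) 2 0 (-2) (by lia)
    exact XClass_of_iso Φ 2 (e.symm ≪≫ (DerivedCategory.homologyFunctor Z 0).mapIso
      (Φ.inverse.mapIso sV.symm)) (X2_PsiH Φ hΦ hΨ _)
  · obtain ⟨e⟩ := sU' 1 0 (by lia)
    exact XClass_of_iso Φ 0 e.symm (X0_PsiH Φ hΦ hΨ _)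

end TorsionPairs
end

section
/- Every quotient object of an object of X_0 lies in K_0; that is, if there is an epimorphism D ↠ E in 𝒵 with D ∈ X_0, then there is a short exact sequence 0 → A → B → E → 0 in 𝒵 with A ∈ X_2 and B ∈ X_0. Consequently, K_0 is exactly the class of quotient objects of objects of X_0, and 𝓔_0 = [X_0] = [B_1 ∩ B_2]. -/
open CategoryTheory Limits Abelian

namespace TorsionPairs

universe w w' v u v' u'

variable {C : Type u} [Category.{v} C] [Abelian C]

variable {Z : Type u} [Category.{v} Z] [Abelian Z] [HasDerivedCategory.{w} Z]
variable {A : Type u'} [Category.{v'} A] [Abelian A] [HasDerivedCategory.{w'} A]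

section Helpers

open DerivedCategory Pretriangulated

/-- The homology of `F X`, for `X` concentrated in degree `n`. -/
lemma exists_single_of_concentrated (X : DerivedCategory Z) (n : ℤ)
    (hX : ∀ j : ℤ, j ≠ n → IsZero ((homologyFunctor Z j).obj X)) :
    ∃ M : Z, Nonempty (X ≅ (singleFunctor Z n).obj M) := by
  have h1 : X.IsGE n := (isGE_iff X n).2 fun i hi => hX i (by lia)
  have h2 : X.IsLE n := (isLE_iff X n).2 fun i hi => hX i (by lia)
  exact exists_iso_singleFunctor_obj_of_isGE_of_isLE X n

/-- Homology of the image of a shifted object. -/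
noncomputable def homologyObjIso (F : DerivedCategory Z ⥤ DerivedCategory A) [F.CommShift ℤ]
    (X : DerivedCategory Z) (n : ℤ) (M : Z) (e : X ≅ (singleFunctor Z n).obj M)
    (j k : ℤ) (h : n + j = k) :
    (homologyFunctor A k).obj (F.obj X) ≅
      (homologyFunctor A j).obj (F.obj ((singleFunctor Z 0).obj M)) :=
  (((homologyFunctor A 0).shiftIso n j k h).app (F.obj X)).symm ≪≫
    (homologyFunctor A j).mapIso ((F.commShiftIso n).symm.app X ≪≫
      F.mapIso ((shiftFunctor _ n).mapIso e ≪≫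
        ((singleFunctors Z).shiftIso n 0 n (by simp)).app M))

lemma extClosure_congr {P Q : C → Prop} (h : ∀ E, P E ↔ Q E) (E : C) :
    ExtClosure P E ↔ ExtClosure Q E := by
  have : P = Q := funext fun E => propext (h E)
  rw [this]

lemma phi2_isZero (Φ : DerivedCategory Z ≌ DerivedCategory A)
    [Φ.functor.CommShift ℤ] [Φ.functor.IsTriangulated]
    (hΦ : ∀ (E : Z) (j : ℤ), j < 0 ∨ 2 < j → IsZero (PhiH Φ j E))
    {D E : Z} (p : D ⟶ E) [Epi p] (hD : XClass Φ 0 D) : IsZero (PhiH Φ 2 E) := by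
  have hS : (ShortComplex.mk (kernel.ι p) p (kernel.condition p)).ShortExact :=
    { exact := ShortComplex.exact_kernel p }
  have hT := Φ.functor.map_distinguished _ hS.singleTriangle_distinguished
  have hex := HomologySequence.exact₃ _ hT 2 3
  exact hex.isZero_of_both_zeros ((hD 2 (by lia)).eq_of_src _ _)
    ((hΦ (kernel p) 3 (by lia)).eq_of_tgt _ _)

lemma main_aux (Φ : DerivedCategory Z ≌ DerivedCategory A)
    [Φ.functor.CommShift ℤ] [Φ.functor.IsTriangulated]
    (hΦ : ∀ (E : Z) (j : ℤ), j < 0 ∨ 2 < j → IsZero (PhiH Φ j E))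
    (hΨ : ∀ (M : A) (j : ℤ), j < -2 ∨ 0 < j → IsZero (PsiH Φ j M))
    {D E : Z} (p : D ⟶ E) [Epi p] (hD : XClass Φ 0 D) : K0Class Φ E := by
  letI : Φ.inverse.CommShift ℤ := Φ.commShiftInverse ℤ
  haveI : Φ.CommShift ℤ := Φ.commShift_of_functor ℤ
  haveI : Φ.inverse.IsTriangulated :=
    (Equivalence.IsTriangulated.mk' Φ inferInstance).rightAdjoint_isTriangulated
  have hE2 := phi2_isZero Φ hΦ p hD
  let SE := (singleFunctor Z 0).obj E
  let SD := (singleFunctor Z 0).obj D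
  obtain ⟨T0, T1, hT0, hT1, a, b, c, hT⟩ :=
    TStructure.t.exists_triangle (Φ.functor.obj SE) 0 1 (by lia)
  have hT0 : T0.IsLE 0 := ⟨hT0⟩
  have hT1 : T1.IsGE 1 := ⟨hT1⟩
  -- homology of `T0` and `T1`
  have cT0 : ∀ j : ℤ, j ≠ 0 → IsZero ((homologyFunctor A j).obj T0) := by
    intro j hj
    rcases lt_or_gt_of_ne hj with h | h
    · exact (HomologySequence.exact₁ _ hT (j - 1) j).isZero_of_both_zeros
        ((isZero_of_isGE T1 1 (j - 1) (by lia)).eq_of_src _ _)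
        ((hΦ E j (by lia)).eq_of_tgt _ _)
    · exact isZero_of_isLE T0 0 j h
  have cT1 : ∀ j : ℤ, j ≠ 1 → IsZero ((homologyFunctor A j).obj T1) := by
    intro j hj
    rcases lt_or_gt_of_ne hj with h | h
    · exact isZero_of_isGE T1 1 j h
    · have hz : IsZero (PhiH Φ j E) := by
        by_cases h2 : j = 2
        · subst h2; exact hE2
        · exact hΦ E j (by lia)
      exact (HomologySequence.exact₃ _ hT j (j + 1)).isZero_of_both_zeros
        (hz.eq_of_src _ _) ((isZero_of_isLE T0 0 (j + 1) (by lia)).eq_of_tgt _ _)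
  obtain ⟨M0, ⟨e0⟩⟩ := exists_single_of_concentrated T0 0 cT0
  obtain ⟨M1, ⟨e1⟩⟩ := exists_single_of_concentrated T1 1 cT1
  have hT' := Φ.inverse.map_distinguished _ hT
  let P0 := Φ.inverse.obj T0
  let P1 := Φ.inverse.obj T1
  let PE := Φ.inverse.obj (Φ.functor.obj SE)
  have z0 : ∀ j : ℤ, j < -2 ∨ 0 < j → IsZero ((homologyFunctor Z j).obj P0) := fun j hj =>
    (hΨ M0 j hj).of_iso (homologyObjIso Φ.inverse T0 0 M0 e0 j j (by lia))
  have z1 : ∀ j : ℤ, j < -1 ∨ 1 < j → IsZero ((homologyFunctor Z j).obj P1) := fun j hj =>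
    (hΨ M1 (j - 1) (by lia)).of_iso
      (homologyObjIso Φ.inverse T1 1 M1 e1 (j - 1) j (by lia))
  have zE : ∀ j : ℤ, j ≠ 0 → IsZero ((homologyFunctor Z j).obj PE) := by
    intro j hj
    refine IsZero.of_iso ?_ ((homologyFunctor Z j).mapIso (Φ.unitIso.app SE).symm)
    rcases lt_or_gt_of_ne hj with h | h
    · exact isZero_of_isGE SE 0 j h
    · exact isZero_of_isLE SE 0 j h
  have epi2 : Epi ((homologyFunctor Z 0).map (Φ.inverse.map b)) :=
    (HomologySequence.epi_homologyMap_mor₂_iff _ hT' 0 1).2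
      ((z0 1 (by lia)).eq_of_tgt _ _)
  have hcomp : Φ.functor.map ((singleFunctor Z 0).map p) ≫ b = 0 := by
    have : (Φ.functor.obj SD).IsLE 0 := (isLE_iff _ _).2 fun i hi => hD i (by lia)
    exact TStructure.t.zero _ 0 1
  have epi1 : Epi ((homologyFunctor Z 0).map
      (Φ.inverse.map (Φ.functor.map ((singleFunctor Z 0).map p)))) := by
    have e : singleFunctor Z 0 ⋙ Φ.functor ⋙ Φ.inverse ⋙ homologyFunctor Z 0 ≅ 𝟭 Z :=
      Functor.isoWhiskerLeft (singleFunctor Z 0)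
        (Functor.isoWhiskerRight Φ.unitIso.symm (homologyFunctor Z 0)) ≪≫
        singleFunctorCompHomologyFunctorIso Z 0
    have h := NatIso.naturality_2 e p
    change (e.hom.app D ≫ p ≫ e.inv.app E) = (homologyFunctor Z 0).map
      (Φ.inverse.map (Φ.functor.map ((singleFunctor Z 0).map p))) at h
    rw [← h]
    infer_instance
  have zP1 : ∀ j : ℤ, j ≠ -1 → IsZero ((homologyFunctor Z j).obj P1) := by
    intro j hj
    by_cases h0 : j = 0
    · subst h0
      have hz : (homologyFunctor Z 0).map
          (Φ.inverse.map (Φ.functor.map ((singleFunctor Z 0).map p))) ≫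
          (homologyFunctor Z 0).map (Φ.inverse.map b) = 0 := by
        rw [← Functor.map_comp, ← Functor.map_comp, hcomp, Functor.map_zero, Functor.map_zero]
      have hb := zero_of_epi_comp _ hz
      exact IsZero.of_epi_eq_zero _ hb
    by_cases h1 : j = 1
    · subst h1
      exact (HomologySequence.exact₃ _ hT' 1 2).isZero_of_both_zeros
        ((zE 1 (by lia)).eq_of_src _ _) ((z0 2 (by lia)).eq_of_tgt _ _)
    · exact z1 j (by lia)
  have zP0 : ∀ j : ℤ, j ≠ 0 → IsZero ((homologyFunctor Z j).obj P0) := by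
    intro j hj
    rcases lt_or_gt_of_ne hj with h | h
    · exact (HomologySequence.exact₁ _ hT' (j - 1) j).isZero_of_both_zeros
        ((zP1 (j - 1) (by lia)).eq_of_src _ _) ((zE j hj).eq_of_tgt _ _)
    · exact z0 j (by lia)
  obtain ⟨B', ⟨f0⟩⟩ := exists_single_of_concentrated P0 0 zP0
  obtain ⟨A', ⟨f1⟩⟩ := exists_single_of_concentrated P1 (-1) zP1
  have hB : XClass Φ 0 B' := fun j hj =>
    ((cT0 j hj).of_iso ((homologyFunctor A j).mapIso (Φ.counitIso.app T0))).of_iso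
      (homologyObjIso Φ.functor P0 0 B' f0 j j (by lia)).symm
  have hA : XClass Φ 2 A' := fun j hj =>
    ((cT1 (j - 1) (by lia)).of_iso
      ((homologyFunctor A (j - 1)).mapIso (Φ.counitIso.app T1))).of_iso
      (homologyObjIso Φ.functor P1 (-1) A' f1 j (j - 1) (by lia)).symm
  let iA : (homologyFunctor Z (-1)).obj P1 ≅ A' :=
    (homologyFunctor Z (-1)).mapIso f1 ≪≫ (singleFunctorCompHomologyFunctorIso Z (-1)).app A'
  let iB : (homologyFunctor Z 0).obj P0 ≅ B' :=
    (homologyFunctor Z 0).mapIso f0 ≪≫ (singleFunctorCompHomologyFunctorIso Z 0).app B'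
  let iE : (homologyFunctor Z 0).obj PE ≅ E :=
    (homologyFunctor Z 0).mapIso (Φ.unitIso.app SE).symm ≪≫
      (singleFunctorCompHomologyFunctorIso Z 0).app E
  have hmono := (HomologySequence.exact₃ _ hT' (-1) 0).mono_g
    ((zE (-1) (by lia)).eq_of_src _ _)
  have hepi := (HomologySequence.exact₂ _ hT' 0).epi_f ((zP1 0 (by lia)).eq_of_tgt _ _)
  have hse : (ShortComplex.mk _ _ (HomologySequence.δ_comp _ hT' (-1) 0)).ShortExact :=
    { exact := HomologySequence.exact₁ _ hT' (-1) 0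
      mono_f := hmono
      epi_g := hepi }
  let δ' : (homologyFunctor Z (-1)).obj P1 ⟶ (homologyFunctor Z 0).obj P0 :=
    HomologySequence.δ (Φ.inverse.mapTriangle.obj (Triangle.mk a b c)) (-1) 0
  let a' : (homologyFunctor Z 0).obj P0 ⟶ (homologyFunctor Z 0).obj PE :=
    (homologyFunctor Z 0).map (Φ.inverse.map a)
  have w' : δ' ≫ a' = 0 := HomologySequence.δ_comp _ hT' (-1) 0
  have hse' : (ShortComplex.mk δ' a' w').ShortExact := hse
  refine ⟨A', B', iA.inv ≫ δ' ≫ iB.hom, iB.inv ≫ a' ≫ iE.hom, hA, hB,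
    by simp [reassoc_of% w'], ?_⟩
  exact ShortComplex.shortExact_of_iso
    (ShortComplex.isoMk iA iB iE (by simp) (by simp)) hse'

end Helpers

/-- Every quotient of an object of `X₀` lies in `K₀`; consequently `K₀` is
exactly the class of quotient objects of objects of `X₀`, and
`𝓔₀ = [X₀] = [B₁ ∩ B₂]`. -/
theorem quotient_of_X0_mem_K0
    (Φ : DerivedCategory Z ≌ DerivedCategory A)
    [Φ.functor.CommShift ℤ] [Φ.functor.IsTriangulated]
    (hΦ : ∀ (E : Z) (j : ℤ), j < 0 ∨ 2 < j → IsZero (PhiH Φ j E))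
    (hΨ : ∀ (M : A) (j : ℤ), j < -2 ∨ 0 < j → IsZero (PsiH Φ j M)) :
    (∀ (D E : Z) (p : D ⟶ E), Epi p → XClass Φ 0 D → K0Class Φ E) ∧
    (∀ E : Z, K0Class Φ E ↔ QuotClass (XClass Φ 0) E) ∧
    (∀ E : Z, ExtClosure (K0Class Φ) E ↔ ExtClosQuot (XClass Φ 0) E) ∧
    (∀ E : Z, ExtClosure (K0Class Φ) E ↔
      ExtClosQuot (fun F => BClassD Φ 1 F ∧ BClassD Φ 2 F) E) := by
  have h1 : ∀ (D E : Z) (p : D ⟶ E), Epi p → XClass Φ 0 D → K0Class Φ E :=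
    fun D E p hp hD => main_aux Φ hΦ hΨ p hD
  have h2 : ∀ E : Z, K0Class Φ E ↔ QuotClass (XClass Φ 0) E := by
    intro E
    constructor
    · rintro ⟨A', B', f, g, _, hB, w, hS⟩
      exact ⟨B', g, hS.epi_g, hB⟩
    · rintro ⟨D, p, hp, hD⟩
      exact h1 D E p hp hD
  have h3 : XClass Φ 0 = fun F => BClassD Φ 1 F ∧ BClassD Φ 2 F := by
    funext F
    refine propext ⟨fun h => ⟨h 1 (by lia), h 2 (by lia)⟩, ?_⟩
    rintro ⟨hF1, hF2⟩ j hj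
    by_cases hj1 : j = 1
    · subst hj1; exact hF1
    by_cases hj2 : j = 2
    · subst hj2; exact hF2
    exact hΦ F j (by lia)
  refine ⟨h1, h2, fun E => extClosure_congr h2 E, fun E => ?_⟩
  rw [← h3]
  exact extClosure_congr h2 E

end TorsionPairs
end
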